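/- Let γ: (0,∞)→(0,∞) be continuous, φ: (0,∞)→[0,∞) measurable with φ/γ locally integrable on (0,∞), let Q(x) = ∫_x^{x̄} φ(y)/γ(y) dy for a fixed x̄ (with Q finite on (0,∞)), and let h: (0,∞)×(0,∞)→[0,∞) be measurable with ∫₀^∞ h(x,y)dx = 1 for every y>0; set H̄(x,y) = ∫_x^∞ h(z,y)dz. Suppose v* ∈ L¹((0,∞)) is nonnegative and Kv* = v*, where Kv(x) = ∫₀^x h(x−z,z)(φ(z)/γ(z)) e^{−Q(z)} (∫_z^∞ v(y) e^{Q(y)} dy) dz. Then the function u*(x) := (1/γ(x)) ∫_x^∞ e^{Q(y)−Q(x)} v*(y) dy satisfies γ(x)u*(x) = ∫₀^x H̄(x−y,y) φ(y) u*(y) dy for all x>0, and φu* ∈ L¹((0,∞)). -/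

import Mathlib

open MeasureTheory

open scoped ENNReal Topology in
lemma exp_ac {P : ℝ → ℝ} {a b : ℝ} (hP : AbsolutelyContinuousOnInterval P a b) :
    AbsolutelyContinuousOnInterval (fun x => Real.exp (P x)) a b := by
  obtain ⟨D, hD⟩ := hP.exists_bound
  have hL : ∀ s t : ℝ, |s| ≤ D → |t| ≤ D → dist (Real.exp s) (Real.exp t) ≤ Real.exp D * dist s t := by
    have key : ∀ s t : ℝ, |s| ≤ D → |t| ≤ D → Real.exp s - Real.exp t ≤ Real.exp D * |s - t| := by
      intro s t hs ht
      have h1 := Real.add_one_le_exp (t - s)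
      have h2 : Real.exp t = Real.exp s * Real.exp (t - s) := by rw [← Real.exp_add]; ring_nf
      have h3 : Real.exp s ≤ Real.exp D := Real.exp_le_exp.2 ((le_abs_self s).trans hs)
      have h4 : Real.exp s - Real.exp t ≤ Real.exp s * (s - t) := by
        rw [h2]; nlinarith [Real.exp_pos s]
      calc _ ≤ _ := h4
        _ ≤ Real.exp s * |s - t| := by gcongr; exact le_abs_self _
        _ ≤ _ := by gcongr
    intro s t hs ht
    rw [Real.dist_eq, Real.dist_eq, abs_le]
    have := key s t hs ht
    have := key t s ht hs
    rw [abs_sub_comm] at this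
    constructor <;> linarith
  rw [absolutelyContinuousOnInterval_iff] at hP ⊢
  intro ε hε
  obtain ⟨δ, hδ, h⟩ := hP (ε / Real.exp D) (by positivity)
  refine ⟨δ, hδ, fun E hE hlt => ?_⟩
  have h1 := h E hE hlt
  rw [lt_div_iff₀ (Real.exp_pos _)] at h1
  refine lt_of_le_of_lt ?_ h1
  rw [Finset.sum_mul]
  refine Finset.sum_le_sum fun i hi => ?_
  rw [mul_comm]
  have := hE.1 i hi
  exact hL _ _ (by simpa using hD _ this.1) (by simpa using hD _ this.2)

lemma exp_ftc {f : ℝ → ℝ} {a b : ℝ} (hf : IntervalIntegrable f volume a b) (C : ℝ) :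
    IntervalIntegrable (fun x => f x * Real.exp (C + ∫ t in a..x, f t)) volume a b ∧
    ∫ x in a..b, f x * Real.exp (C + ∫ t in a..x, f t)
      = Real.exp (C + ∫ t in a..b, f t) - Real.exp C := by
  have h1 := hf.absolutelyContinuousOnInterval_intervalIntegral (c := a) (by simp)
  have hc : AbsolutelyContinuousOnInterval (fun x => Real.exp (∫ t in a..x, f t)) a b := exp_ac h1
  have h2 : AbsolutelyContinuousOnInterval (fun x => Real.exp (C + ∫ t in a..x, f t)) a b := by
    simpa [Real.exp_add] using hc.const_mul (Real.exp C)
  refine ⟨hf.mul_continuousOn h2.continuousOn, ?_⟩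
  have h3 := h2.integral_deriv_eq_sub
  simp only [intervalIntegral.integral_same, add_zero] at h3
  rw [← h3]
  apply intervalIntegral.integral_congr_ae
  filter_upwards [hf.ae_hasDerivAt_integral] with x hx hxm
  have := ((hx (Set.uIoc_subset_uIcc hxm) a (by simp)).const_add C).exp
  rw [this.deriv]; ring

open scoped ENNReal

lemma ton (A B : ℝ → ℝ≥0∞) (hA : Measurable A) (hB : Measurable B) (x : ℝ) :
    ∫⁻ z in Set.Ioi x, A z * ∫⁻ y in Set.Ioi z, B y
      = ∫⁻ y in Set.Ioi x, B y * ∫⁻ z in Set.Ioc x y, A z := by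
  have hS : MeasurableSet {p : ℝ × ℝ | x < p.1 ∧ p.1 < p.2} := by
    apply MeasurableSet.inter
    · exact measurableSet_lt measurable_const measurable_fst
    · exact measurableSet_lt measurable_fst measurable_snd
  let F : ℝ → ℝ → ℝ≥0∞ := fun z y => {p : ℝ × ℝ | x < p.1 ∧ p.1 < p.2}.indicator (fun p => A p.1 * B p.2) (z, y)
  have hF : Measurable (Function.uncurry F) := by
    apply Measurable.indicator _ hS
    exact (hA.comp measurable_fst).mul (hB.comp measurable_snd)
  have h1 : ∫⁻ z in Set.Ioi x, A z * ∫⁻ y in Set.Ioi z, B y = ∫⁻ z, ∫⁻ y, F z y := by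
    rw [← lintegral_indicator measurableSet_Ioi]
    congr 1; ext z
    by_cases hz : x < z
    · rw [Set.indicator_of_mem (by exact hz), ← lintegral_const_mul _ hB, ← lintegral_indicator measurableSet_Ioi]
      congr 1; ext y
      by_cases hy : z < y <;> simp [F, Set.indicator, hz, hy]
    · simp [F, Set.indicator, hz]
  have h2 : ∫⁻ y in Set.Ioi x, B y * ∫⁻ z in Set.Ioc x y, A z = ∫⁻ y, ∫⁻ z, F z y := by
    rw [← lintegral_indicator measurableSet_Ioi]
    congr 1; ext y
    by_cases hy : x < y
    · rw [Set.indicator_of_mem (by exact hy), ← restrict_Ioo_eq_restrict_Ioc, ← lintegral_const_mul _ hA, ← lintegral_indicator measurableSet_Ioo]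
      congr 1; ext z
      by_cases hz : x < z ∧ z < y <;> simp [F, Set.indicator, hz, mul_comm]
    · have : ∀ z, F z y = 0 := by
        intro z
        simp only [F, Set.indicator, Set.mem_ofPred_eq]
        rw [if_neg]; rintro ⟨h1, h2⟩; exact hy (h1.trans h2)
      simp [this, hy]
  rw [h1, h2, lintegral_lintegral_swap hF.aemeasurable]

lemma core (A E E' V : ℝ → ℝ≥0∞) (hA : Measurable A) (hE : Measurable E) (hV : Measurable V)
    (hEE : ∀ y, 0 < y → E y * E' y = 1)
    (hftc : ∀ a b, 0 < a → a ≤ b → (∫⁻ z in Set.Ioc a b, A z) + E' a = E' b) (x : ℝ) (hx : 0 < x) :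
    (∫⁻ z in Set.Ioi x, A z * ∫⁻ y in Set.Ioi z, V y * E y) + E' x * ∫⁻ y in Set.Ioi x, V y * E y
      = ∫⁻ y in Set.Ioi x, V y := by
  have hVE : Measurable (fun y => V y * E y) := hV.mul hE
  rw [ton A (fun y => V y * E y) hA hVE, ← lintegral_const_mul _ hVE, ← lintegral_add_right _ (by fun_prop)]
  apply setLIntegral_congr_fun measurableSet_Ioi
  intro y hy
  have hy : x < y := hy
  simp only
  calc _ = V y * E y * ((∫⁻ z in Set.Ioc x y, A z) + E' x) := by ring
    _ = _ := by rw [hftc x y hx hy.le, mul_assoc, hEE y (hx.trans hy), mul_one]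

lemma core0 (g : ℝ → ℝ≥0∞) (c : ℝ≥0∞)
    (H : ∀ x, 0 < x → ∫⁻ z in Set.Ioi x, g z ≤ c) : ∫⁻ z in Set.Ioi (0:ℝ), g z ≤ c := by
  have : Set.Ioi (0:ℝ) = ⋃ n : ℕ, Set.Ioi (1 / ((n:ℝ) + 1)) := by
    ext x
    simp only [Set.mem_Ioi, Set.mem_iUnion]
    constructor
    · intro hx; exact exists_nat_one_div_lt hx
    · rintro ⟨n, hn⟩; exact lt_trans (by positivity) hn
  rw [this, setLIntegral_iUnion_of_directed]
  · exact iSup_le fun n => H _ (by positivity)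
  · apply directed_of_isDirected_le
    intro m n hmn
    apply Set.Ioi_subset_Ioi
    exact Nat.one_div_le_one_div hmn

lemma conv (k : ℝ → ℝ → ℝ≥0∞) (g : ℝ → ℝ≥0∞) (hk : Measurable (Function.uncurry k)) (hg : Measurable g)
    (x : ℝ) :
    ∫⁻ s in Set.Ioi x, ∫⁻ z in Set.Ioi 0, k (s - z) z * g z
      = ∫⁻ z in Set.Ioi 0, (∫⁻ w in Set.Ioi (x - z), k w z) * g z := by
  have hm : Measurable (fun p : ℝ × ℝ => k (p.1 - p.2) p.2) :=
    hk.comp ((measurable_fst.sub measurable_snd).prodMk measurable_snd)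
  rw [lintegral_lintegral_swap]
  · congr 1; ext z
    rw [lintegral_mul_const]
    · congr 1
      rw [← lintegral_indicator measurableSet_Ioi, ← lintegral_indicator measurableSet_Ioi,
        ← lintegral_sub_right_eq_self ((Set.Ioi (x - z)).indicator _) z]
      congr 1; ext s
      by_cases hs : x < s <;> simp [Set.indicator, hs]
    · exact hm.comp (measurable_id.prodMk measurable_const)
  · exact (hm.mul (hg.comp measurable_snd)).aemeasurable

lemma conv2 (k : ℝ → ℝ → ℝ≥0∞) (g : ℝ → ℝ≥0∞) (hk : Measurable (Function.uncurry k)) (hg : Measurable g)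
    (hk0 : ∀ w z, w ≤ 0 → k w z = 0) (hk1 : ∀ z, 0 < z → ∫⁻ w in Set.Ioi 0, k w z = 1)
    (x : ℝ) (hx : 0 ≤ x) :
    ∫⁻ s in Set.Ioi x, ∫⁻ z in Set.Ioi 0, k (s - z) z * g z
      = (∫⁻ z in Set.Ioc 0 x, (∫⁻ w in Set.Ioi (x - z), k w z) * g z) + ∫⁻ z in Set.Ioi x, g z := by
  rw [conv k g hk hg, ← Set.Ioc_union_Ioi_eq_Ioi hx, lintegral_union measurableSet_Ioi]
  · congr 1
    apply setLIntegral_congr_fun measurableSet_Ioi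
    intro z hz
    have hz : x < z := hz
    simp only
    have : ∫⁻ w in Set.Ioi (x - z), k w z = 1 := by
      rw [← hk1 z (by linarith), ← lintegral_indicator measurableSet_Ioi, ← lintegral_indicator measurableSet_Ioi]
      congr 1; ext w
      by_cases hw : 0 < w
      · have : x - z < w := by linarith
        simp [Set.indicator, hw, this]
      · simp [Set.indicator, hk0 w z (not_lt.1 hw)]
    rw [this, one_mul]
  · exact Set.Ioc_disjoint_Ioi le_rfl

theorem stmt11 (γ φ Q : ℝ → ℝ) (xbar : ℝ) (h : ℝ → ℝ → ℝ) (vstar ustar : ℝ → ℝ)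
    (hγc : ContinuousOn γ (Set.Ioi 0)) (hγpos : ∀ x, 0 < x → 0 < γ x)
    (hφm : Measurable φ) (hφ : ∀ x, 0 < x → 0 ≤ φ x)
    (hloc : LocallyIntegrableOn (fun y => φ y / γ y) (Set.Ioi 0))
    (hxbar : 0 < xbar)
    (hQint : ∀ x, 0 < x → IntervalIntegrable (fun y => φ y / γ y) volume x xbar)
    (hQ : ∀ x, 0 < x → Q x = ∫ y in x..xbar, φ y / γ y)
    (hhm : Measurable (Function.uncurry h))
    (hh : ∀ x y, 0 < x → 0 < y → 0 ≤ h x y)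
    (hh1 : ∀ y, 0 < y → (∫ x in Set.Ioi (0 : ℝ), h x y) = 1)
    (hvL1 : IntegrableOn vstar (Set.Ioi 0)) (hv : ∀ x, 0 < x → 0 ≤ vstar x)
    (hfix : ∀ᵐ x ∂(volume.restrict (Set.Ioi (0 : ℝ))),
      (∫ z in Set.Ioc (0 : ℝ) x, h (x - z) z * (φ z / γ z) * Real.exp (-(Q z))
          * ∫ y in Set.Ioi z, vstar y * Real.exp (Q y))
        = vstar x)
    (hu : ∀ x, 0 < x → ustar x
      = (1 / γ x) * ∫ y in Set.Ioi x, Real.exp (Q y - Q x) * vstar y) :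
    (∀ x, 0 < x → γ x * ustar x
      = ∫ y in Set.Ioc (0 : ℝ) x, (∫ z in Set.Ioi (x - y), h z y) * φ y * ustar y) ∧
    IntegrableOn (fun y => φ y * ustar y) (Set.Ioi 0) := by
  have hab : ∀ a b, 0 < a → 0 < b → IntervalIntegrable (fun y => φ y / γ y) volume a b :=
    fun a b ha hb => (hQint a ha).trans (hQint b hb).symm
  have hQs : ∀ a b, 0 < a → 0 < b → -Q b = -Q a + ∫ y in a..b, φ y / γ y := by
    intro a b ha hb
    rw [hQ a ha, hQ b hb, ← intervalIntegral.integral_add_adjacent_intervals (hab a b ha hb) (hQint b hb)]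
    ring
  have hr0 : ∀ y, 0 < y → 0 ≤ φ y / γ y := fun y hy => div_nonneg (hφ y hy) (hγpos y hy).le
  have hanti : ∀ a b, 0 < a → a ≤ b → Q b ≤ Q a := by
    intro a b ha hb
    have h1 := hQs a b ha (ha.trans_le hb)
    have h2 : 0 ≤ ∫ y in a..b, φ y / γ y :=
      intervalIntegral.integral_nonneg hb (fun u hu => hr0 u (ha.trans_le hu.1))
    linarith
  let E : ℝ → ℝ≥0∞ := fun z => if 0 < z then ENNReal.ofReal (Real.exp (Q z)) else ⊤
  let E' : ℝ → ℝ≥0∞ := fun z => (E z)⁻¹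
  have hEp : ∀ z, 0 < z → E z = ENNReal.ofReal (Real.exp (Q z)) := fun z hz => by simp [E, hz]
  have hE'p : ∀ z, 0 < z → E' z = ENNReal.ofReal (Real.exp (-Q z)) := fun z hz => by
    simp only [E', hEp z hz]
    rw [Real.exp_neg, ENNReal.ofReal_inv_of_pos (Real.exp_pos _)]
  have hEanti : Antitone E := by
    intro a b h
    by_cases ha : 0 < a
    · rw [hEp a ha, hEp b (ha.trans_le h)]
      exact ENNReal.ofReal_le_ofReal (Real.exp_le_exp.2 (hanti a b ha h))
    · simp [E, ha]
  have hEm : Measurable E := hEanti.measurable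
  have hE'm : Measurable E' := hEm.inv
  have hEE : ∀ y, 0 < y → E y * E' y = 1 := by
    intro y hy
    apply ENNReal.mul_inv_cancel
    · rw [hEp y hy]; simp [Real.exp_pos]
    · rw [hEp y hy]; simp
  let γ' : ℝ → ℝ := (Set.Ioi (0:ℝ)).piecewise γ (fun _ => 0)
  have hγ'm : Measurable γ' := hγc.measurable_piecewise continuousOn_const measurableSet_Ioi
  have hγ'p : ∀ z, 0 < z → γ' z = γ z := fun z hz => by simp [γ', Set.piecewise, hz]
  let A : ℝ → ℝ≥0∞ := fun z => ENNReal.ofReal (φ z / γ' z) * E' z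
  have hAm : Measurable A := (hφm.div hγ'm).ennreal_ofReal.mul hE'm
  have hAp : ∀ z, 0 < z → A z = ENNReal.ofReal (φ z / γ z * Real.exp (-Q z)) := by
    intro z hz
    simp only [A]
    rw [hγ'p z hz, hE'p z hz, ENNReal.ofReal_mul (hr0 z hz)]
  have hftc : ∀ a b, 0 < a → a ≤ b → (∫⁻ z in Set.Ioc a b, A z) + E' a = E' b := by
    intro a b ha hle
    have hb := ha.trans_le hle
    obtain ⟨h1, h2⟩ := exp_ftc (hab a b ha hb) (-Q a)
    rw [← hQs a b ha hb, intervalIntegral.integral_of_le hle] at h2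
    rw [intervalIntegrable_iff_integrableOn_Ioc_of_le hle] at h1
    have h3 : ∫⁻ z in Set.Ioc a b, A z = ENNReal.ofReal (Real.exp (-Q b) - Real.exp (-Q a)) := by
      rw [← h2, ofReal_integral_eq_lintegral_ofReal h1]
      · apply setLIntegral_congr_fun measurableSet_Ioc
        intro z hz
        have hz0 : 0 < z := ha.trans hz.1
        simp only
        rw [hAp z hz0, hQs a z ha hz0]
      · filter_upwards [ae_restrict_mem measurableSet_Ioc] with z hz
        exact mul_nonneg (hr0 z (ha.trans hz.1)) (Real.exp_pos _).le
    rw [h3, hE'p a ha, hE'p b hb, ← ENNReal.ofReal_add _ (Real.exp_pos _).le]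
    · congr 1; ring
    · have := hanti a b ha hle
      rw [sub_nonneg]; exact Real.exp_le_exp.2 (by linarith)
  let V : ℝ → ℝ≥0∞ := fun y => ENNReal.ofReal (hvL1.1.mk vstar y)
  have hVm : Measurable V := hvL1.1.stronglyMeasurable_mk.measurable.ennreal_ofReal
  have hVae : ∀ᵐ y ∂(volume.restrict (Set.Ioi (0:ℝ))), V y = ENNReal.ofReal (vstar y) := by
    filter_upwards [hvL1.1.ae_eq_mk] with y hy
    simp only [V]; rw [← hy]
  have hVfin : ∫⁻ y in Set.Ioi (0:ℝ), V y < ⊤ := by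
    rw [lintegral_congr_ae hVae]
    exact hvL1.lintegral_lt_top
  have hmono : ∀ x : ℝ, 0 < x → volume.restrict (Set.Ioi x) ≤ volume.restrict (Set.Ioi (0:ℝ)) :=
    fun x hx => Measure.restrict_mono_set _ (Set.Ioi_subset_Ioi hx.le)
  have hVfinx : ∀ x, 0 < x → ∫⁻ y in Set.Ioi x, V y < ⊤ := fun x hx =>
    (lintegral_mono' (hmono x hx) le_rfl).trans_lt hVfin
  let G : ℝ → ℝ≥0∞ := fun z => ∫⁻ y in Set.Ioi z, V y * E y
  have hGm : Measurable G := by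
    apply Antitone.measurable
    intro a b h
    exact lintegral_mono' (Measure.restrict_mono_set _ (Set.Ioi_subset_Ioi h)) le_rfl
  have hGfin : ∀ z, 0 < z → G z < ⊤ := by
    intro z hz
    calc G z ≤ ∫⁻ y in Set.Ioi z, V y * E z := by
          apply setLIntegral_mono (hVm.mul_const _)
          intro y hy
          gcongr
          exact hEanti (le_of_lt hy)
      _ = (∫⁻ y in Set.Ioi z, V y) * E z := lintegral_mul_const _ hVm
      _ < ⊤ := ENNReal.mul_lt_top (hVfinx z hz) (by rw [hEp z hz]; exact ENNReal.ofReal_lt_top)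
  have hGr : ∀ z, 0 < z → ∫ y in Set.Ioi z, vstar y * Real.exp (Q y) = (G z).toReal := by
    intro z hz
    change _ = (∫⁻ y in Set.Ioi z, (V * E) y).toReal
    rw [← integral_toReal (hVm.mul hEm).aemeasurable]
    · apply integral_congr_ae
      filter_upwards [ae_mono (hmono z hz) hVae, ae_restrict_mem measurableSet_Ioi] with y hy hyz
      have hy0 : 0 < y := hz.trans hyz
      rw [Pi.mul_apply, hy, hEp y hy0, ENNReal.toReal_mul, ENNReal.toReal_ofReal (hv y hy0),
        ENNReal.toReal_ofReal (Real.exp_pos _).le]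
    · exact ae_lt_top (hVm.mul hEm) (hGfin z hz).ne
  let g : ℝ → ℝ≥0∞ := fun z => A z * G z
  have hgm : Measurable g := hAm.mul hGm
  have hu2 : ∀ z, 0 < z → γ z * ustar z = Real.exp (-Q z) * (G z).toReal := by
    intro z hz
    rw [hu z hz, ← hGr z hz]
    rw [← mul_assoc, mul_one_div_cancel (hγpos z hz).ne', one_mul, ← integral_const_mul]
    congr 1; ext y
    rw [sub_eq_add_neg, Real.exp_add]; ring
  have hgr : ∀ z, 0 < z → (g z).toReal = φ z / γ z * Real.exp (-Q z) * (G z).toReal := by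
    intro z hz
    simp only [g]
    rw [ENNReal.toReal_mul, hAp z hz, ENNReal.toReal_ofReal (mul_nonneg (hr0 z hz) (Real.exp_pos _).le)]
  have hgu : ∀ z, 0 < z → φ z * ustar z = (g z).toReal := by
    intro z hz
    rw [hgr z hz, mul_assoc, ← hu2 z hz]
    have := (hγpos z hz).ne'
    field_simp
  have hgfin : ∀ z, 0 < z → g z < ⊤ := fun z hz =>
    ENNReal.mul_lt_top (by rw [hAp z hz]; exact ENNReal.ofReal_lt_top) (hGfin z hz)
  have hcore : ∀ x, 0 < x → (∫⁻ z in Set.Ioi x, g z) + E' x * G x = ∫⁻ y in Set.Ioi x, V y :=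
    fun x hx => core A E E' V hAm hEm hVm hEE hftc x hx
  have hgI : ∫⁻ z in Set.Ioi (0:ℝ), g z < ⊤ := by
    refine (core0 g (∫⁻ y in Set.Ioi (0:ℝ), V y) fun x hx => ?_).trans_lt hVfin
    refine le_trans ?_ (lintegral_mono' (hmono x hx) le_rfl)
    rw [← hcore x hx]
    exact le_self_add
  let k : ℝ → ℝ → ℝ≥0∞ := fun w z => if 0 < w then ENNReal.ofReal (h w z) else 0
  have hkm : Measurable (Function.uncurry k) := by
    apply Measurable.ite (measurableSet_lt measurable_const measurable_fst) hhm.ennreal_ofReal measurable_const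
  have hk0 : ∀ w z, w ≤ 0 → k w z = 0 := fun w z hw => by simp [k, not_lt.2 hw]
  have hkp : ∀ w z, 0 < w → k w z = ENNReal.ofReal (h w z) := fun w z hw => by simp [k, hw]
  have hkfin : ∀ w z, k w z < ⊤ := fun w z => by
    simp only [k]; split_ifs <;> simp
  have hhint : ∀ z, 0 < z → IntegrableOn (fun w => h w z) (Set.Ioi 0) := by
    intro z hz
    by_contra hcon
    have := hh1 z hz
    rw [integral_undef hcon] at this
    exact zero_ne_one this
  have hkx : ∀ z t, 0 < z → 0 ≤ t → ∫⁻ w in Set.Ioi t, k w z = ENNReal.ofReal (∫ w in Set.Ioi t, h w z) := by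
    intro z t hz ht
    rw [ofReal_integral_eq_lintegral_ofReal ((hhint z hz).mono_set (Set.Ioi_subset_Ioi ht))]
    · apply setLIntegral_congr_fun measurableSet_Ioi
      intro w hw
      exact hkp w z (ht.trans_lt hw)
    · filter_upwards [ae_restrict_mem measurableSet_Ioi] with w hw
      exact hh w z (ht.trans_lt hw) hz
  have hk1 : ∀ z, 0 < z → ∫⁻ w in Set.Ioi 0, k w z = 1 := by
    intro z hz
    rw [hkx z 0 hz le_rfl, hh1 z hz, ENNReal.ofReal_one]
  have hconvm : Measurable (fun p : ℝ × ℝ => k (p.1 - p.2) p.2 * g p.2) :=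
    (hkm.comp ((measurable_fst.sub measurable_snd).prodMk measurable_snd)).mul (hgm.comp measurable_snd)
  have hCm : Measurable (fun s => ∫⁻ z in Set.Ioi 0, k (s - z) z * g z) :=
    hconvm.lintegral_prod_right'
  have hCfin : ∀ᵐ s ∂(volume.restrict (Set.Ioi (0:ℝ))), ∫⁻ z in Set.Ioi 0, k (s - z) z * g z < ⊤ := by
    apply ae_lt_top hCm
    rw [conv2 k g hkm hgm hk0 hk1 0 le_rfl]
    simpa using hgI.ne
  have hfixV : ∀ᵐ s ∂(volume.restrict (Set.Ioi (0:ℝ))), ∫⁻ z in Set.Ioi 0, k (s - z) z * g z = V s := by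
    filter_upwards [hCfin, hfix, hVae, ae_restrict_mem measurableSet_Ioi] with s h1 h2 h3 hs
    have hs : 0 < s := hs
    have h4 : ∫⁻ z in Set.Ioi 0, k (s - z) z * g z = ∫⁻ z in Set.Ioo 0 s, k (s - z) z * g z := by
      rw [← lintegral_indicator measurableSet_Ioi, ← lintegral_indicator measurableSet_Ioo]
      congr 1; ext z
      by_cases hz : 0 < z
      · by_cases hzs : z < s
        · simp [Set.indicator, hz, hzs]
        · simp [Set.indicator, hz, hzs, hk0 (s - z) z (by linarith)]
      · simp [Set.indicator, hz]
    have hm1 : Measurable (fun z => k (s - z) z * g z) :=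
      hconvm.comp (measurable_const.prodMk measurable_id)
    rw [h3, ← h2, h4, ← restrict_Ioo_eq_restrict_Ioc]
    rw [h4] at h1
    rw [← ENNReal.ofReal_toReal h1.ne, ← integral_toReal hm1.aemeasurable (ae_lt_top hm1 h1.ne)]
    congr 1
    apply setIntegral_congr_fun measurableSet_Ioo
    intro z hz
    have hz1 : 0 < s - z := sub_pos.2 hz.2
    simp only
    rw [hGr z hz.1, ENNReal.toReal_mul, hgr z hz.1, hkp _ z hz1, ENNReal.toReal_ofReal (hh _ _ hz1 hz.1)]
    ring
  refine ⟨fun x hx => ?_, ?_⟩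
  · have h1 : ∫⁻ y in Set.Ioi x, V y
        = (∫⁻ z in Set.Ioc 0 x, (∫⁻ w in Set.Ioi (x - z), k w z) * g z) + ∫⁻ z in Set.Ioi x, g z := by
      rw [← conv2 k g hkm hgm hk0 hk1 x hx.le]
      apply lintegral_congr_ae
      filter_upwards [ae_mono (hmono x hx) hfixV] with s hs
      exact hs.symm
    have hgx : ∫⁻ z in Set.Ioi x, g z < ⊤ := (lintegral_mono' (hmono x hx) le_rfl).trans_lt hgI
    rw [← hcore x hx, add_comm, ENNReal.add_left_inj hgx.ne] at h1
    have h2 : γ x * ustar x = (E' x * G x).toReal := by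
      rw [hu2 x hx, ENNReal.toReal_mul, hE'p x hx, ENNReal.toReal_ofReal (Real.exp_pos _).le]
    have hfin : E' x * G x < ⊤ :=
      ENNReal.mul_lt_top (by rw [hE'p x hx]; exact ENNReal.ofReal_lt_top) (hGfin x hx)
    rw [h1] at hfin
    have hm2 : AEMeasurable (fun z => (∫⁻ w in Set.Ioi (x - z), k w z) * g z)
        (volume.restrict (Set.Ioc 0 x)) := by
      apply AEMeasurable.mul _ hgm.aemeasurable
      let K : ℝ → ℝ → ℝ≥0∞ := fun z w => {p : ℝ × ℝ | x - p.1 < p.2}.indicator (fun p => k p.2 p.1) (z, w)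
      have hK : Measurable (Function.uncurry K) :=
        (hkm.comp measurable_swap).indicator
          (measurableSet_lt (measurable_const.sub measurable_fst) measurable_snd)
      have : (fun z => ∫⁻ w in Set.Ioi (x - z), k w z) = fun z => ∫⁻ w, K z w := by
        ext z
        rw [← lintegral_indicator measurableSet_Ioi]
        congr 1
      rw [this]
      exact hK.lintegral_prod_right'.aemeasurable
    rw [h2, h1, ← integral_toReal hm2 (ae_lt_top' hm2 hfin.ne)]
    apply setIntegral_congr_fun measurableSet_Ioc
    intro z hz
    have hH : 0 ≤ ∫ w in Set.Ioi (x - z), h w z :=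
      setIntegral_nonneg measurableSet_Ioi fun w hw => hh w z ((sub_nonneg.2 hz.2).trans_lt hw) hz.1
    simp only
    rw [ENNReal.toReal_mul, ← hgu z hz.1, hkx z _ hz.1 (sub_nonneg.2 hz.2), ENNReal.toReal_ofReal hH]
    ring
  · have := integrable_toReal_of_lintegral_ne_top hgm.aemeasurable hgI.ne
    refine this.congr ?_
    filter_upwards [ae_restrict_mem measurableSet_Ioi] with z hz
    exact (hgu z hz).symm
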